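/- arXiv:1311.2337 — 2 statements merged into one kernel-verified Lean document; each statement's English description precedes it below -/
import Mathlib

section
/- Fix P > 0 and s > 0. For n ≥ 3 let ν_n be the probability measure on [−1,1] with density proportional to (1−u²)^{(n−3)/2}·exp(n·√(Ps)·u) with respect to Lebesgue measure. Then there exists N ∈ ℕ (depending only on P and s) such that for all n ≥ N, all a ∈ ℝ and all μ > 0, ν_n( { u ∈ [−1,1] : n·√(Ps)·u ∈ [a, a+μ] } ) ≤ 2·L(P,s)·μ / √(n·P·s). -/
open MeasureTheory Real
open scoped ENNReal

noncomputable section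

/-- The constant `L(P,s)` from the paper. -/
def L (P s : ℝ) : ℝ :=
  (2 * P * s) ^ 2 / Real.sqrt (2 * π) *
    Real.sqrt ((1 + 4 * P * s - Real.sqrt (1 + 4 * P * s)) /
      (Real.sqrt (1 + 4 * P * s) - 1) ^ 5)

/-- Unnormalized density `(1-u²)^{(n-3)/2} exp(n √(Ps) u)` on `[-1,1]`. -/
def g (P s : ℝ) (n : ℕ) (u : ℝ) : ℝ :=
  (1 - u ^ 2) ^ (((n : ℝ) - 3) / 2) * Real.exp (n * Real.sqrt (P * s) * u)

/-- Normalization constant `F_n = ∫_{-1}^1 (1-u²)^{(n-3)/2} exp(n √(Ps) u) du`. -/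
def Fnorm (P s : ℝ) (n : ℕ) : ℝ := ∫ u in Set.Icc (-1 : ℝ) 1, g P s n u

/-- The probability measure `ν_n` on `[-1,1]` with density proportional to
`(1-u²)^{(n-3)/2} exp(n √(Ps) u)` with respect to Lebesgue measure. -/
def nuMeasure (P s : ℝ) (n : ℕ) : Measure ℝ :=
  (ENNReal.ofReal (Fnorm P s n))⁻¹ •
    ((volume.restrict (Set.Icc (-1 : ℝ) 1)).withDensity fun u => ENNReal.ofReal (g P s n u))

open Filter Topology

/-- The maximizer of `log (1 - u²) / 2 + c u` on `(-1, 1)`. -/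
def saddle (c : ℝ) : ℝ := 2 * c / (√(1 + 4 * c ^ 2) + 1)

lemma one_sub_saddle_sq (c : ℝ) : 1 - saddle c ^ 2 = 2 / (√(1 + 4 * c ^ 2) + 1) := by
  have h : √(1 + 4 * c ^ 2) ^ 2 = 1 + 4 * c ^ 2 := Real.sq_sqrt (by positivity)
  have h0 := Real.sqrt_nonneg (1 + 4 * c ^ 2)
  unfold saddle
  generalize √(1 + 4 * c ^ 2) = r at h h0
  field_simp
  linear_combination h

lemma one_sub_saddle_sq_pos (c : ℝ) : 0 < 1 - saddle c ^ 2 := by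
  rw [one_sub_saddle_sq]
  positivity

lemma saddle_eq (c : ℝ) : saddle c / (1 - saddle c ^ 2) = c := by
  rw [one_sub_saddle_sq, saddle]
  field_simp

lemma continuous_saddle : Continuous saddle := by
  unfold saddle
  refine Continuous.div (by fun_prop) (by fun_prop) fun c => ?_
  positivity

lemma log_one_sub_ge {w : ℝ} (hw : |w| ≤ 1 / 2) :
    -w - w ^ 2 * (1 / 2 + 2 * |w|) ≤ log (1 - w) := by
  have h := (abs_le.1 (abs_log_sub_add_sum_range_le (x := w) (by linarith) 2)).1
  have h2 : |w| ^ (2 + 1) / (1 - |w|) ≤ 2 * |w| ^ 3 := by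
    rw [div_le_iff₀ (by linarith)]
    have := mul_nonneg (pow_nonneg (abs_nonneg w) 3) (sub_nonneg.2 hw)
    generalize |w| = y at this
    linear_combination 2 * this
  have h3 : |w| ^ 3 = w ^ 2 * |w| := by rw [pow_succ, sq_abs]
  norm_num [Finset.sum_range_succ] at h
  linarith

lemma log_one_sub_sq_le {v u : ℝ} (hv : 0 < 1 - v ^ 2) (hu : 0 < 1 - u ^ 2) :
    log (1 - u ^ 2) ≤ log (1 - v ^ 2) - 2 * (v / (1 - v ^ 2)) * (u - v) := by
  have h := Real.log_le_sub_one_of_pos (div_pos hu hv)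
  rw [Real.log_div hu.ne' hv.ne'] at h
  have h2 : (1 - u ^ 2) / (1 - v ^ 2) - 1 ≤ - (2 * (v / (1 - v ^ 2)) * (u - v)) := by
    have : - (2 * (v / (1 - v ^ 2)) * (u - v)) - ((1 - u ^ 2) / (1 - v ^ 2) - 1)
        = (u - v) ^ 2 / (1 - v ^ 2) := by
      field_simp
      ring
    have : 0 ≤ (u - v) ^ 2 / (1 - v ^ 2) := by positivity
    linarith
  linarith

/-- A quadratic minorant of `log (1 - u²)` around `v`, locally uniform in `v`. -/
lemma exists_log_one_sub_sq_ge {v₀ B : ℝ} (hv₀ : 0 < 1 - v₀ ^ 2)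
    (hB : 1 + v₀ ^ 2 < B * (1 - v₀ ^ 2) ^ 2) :
    ∃ δ > 0, ∀ᶠ v in 𝓝 v₀, ∀ t, |t| ≤ δ → 0 < 1 - (v + t) ^ 2 ∧
      log (1 - v ^ 2) - 2 * (v / (1 - v ^ 2)) * t - B * t ^ 2 ≤ log (1 - (v + t) ^ 2) := by
  let w : ℝ × ℝ → ℝ := fun p => (2 * p.1 * p.2 + p.2 ^ 2) / (1 - p.1 ^ 2)
  have hw : ContinuousAt w (v₀, 0) := by
    refine ContinuousAt.div (by fun_prop) (by fun_prop) hv₀.ne'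
  have hw0 : w (v₀, 0) = 0 := by simp [w]
  have e1 : ∀ᶠ p in 𝓝 (v₀, (0 : ℝ)), 0 < 1 - p.1 ^ 2 :=
    continuousAt_const.eventually_lt (by fun_prop) hv₀
  have e2 : ∀ᶠ p in 𝓝 (v₀, (0 : ℝ)), 0 < 1 - (p.1 + p.2) ^ 2 :=
    continuousAt_const.eventually_lt (by fun_prop) (by simpa using hv₀)
  have e3 : ∀ᶠ p in 𝓝 (v₀, (0 : ℝ)), |w p| < 1 / 2 :=
    hw.abs.eventually_lt continuousAt_const (by simp [hw0])
  have e4 : ∀ᶠ p in 𝓝 (v₀, (0 : ℝ)),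
      (1 - p.1 ^ 2) + (1 / 2 + 2 * |w p|) * (2 * p.1 + p.2) ^ 2 < B * (1 - p.1 ^ 2) ^ 2 := by
    have := hw.abs
    refine ContinuousAt.eventually_lt (by fun_prop) (by fun_prop) ?_
    simp only [hw0, abs_zero]
    linarith
  obtain ⟨ε, hε, H⟩ := Metric.eventually_nhds_iff.1 (e1.and (e2.and (e3.and e4)))
  refine ⟨ε / 2, by positivity, ?_⟩
  filter_upwards [Metric.ball_mem_nhds v₀ hε] with v hv t ht
  have hd : dist (v, t) (v₀, (0 : ℝ)) < ε := by
    rw [Prod.dist_eq, max_lt_iff]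
    refine ⟨hv, ?_⟩
    simp only [Real.dist_eq, sub_zero]
    linarith
  obtain ⟨h1, h2, h3, h4⟩ := H hd
  dsimp only at h1 h2 h4
  refine ⟨h2, ?_⟩
  have hlog := log_one_sub_ge h3.le
  have h5 : 1 - w (v, t) = (1 - (v + t) ^ 2) / (1 - v ^ 2) := by
    simp only [w]
    field_simp
    ring
  rw [h5, Real.log_div h2.ne' h1.ne'] at hlog
  have h6 : w (v, t) + w (v, t) ^ 2 * (1 / 2 + 2 * |w (v, t)|) - 2 * (v / (1 - v ^ 2)) * t
      = t ^ 2 * (((1 - v ^ 2) + (1 / 2 + 2 * |w (v, t)|) * (2 * v + t) ^ 2)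
        / (1 - v ^ 2) ^ 2) := by
    generalize |w (v, t)| = y
    simp only [w]
    field_simp
    ring
  have h7 : ((1 - v ^ 2) + (1 / 2 + 2 * |w (v, t)|) * (2 * v + t) ^ 2) / (1 - v ^ 2) ^ 2 ≤ B := by
    rw [div_le_iff₀ (by positivity)]
    exact h4.le
  have h8 := mul_le_mul_of_nonneg_left h7 (sq_nonneg t)
  linarith

lemma tendsto_sqrt_mul_gaussian_integral {B δ : ℝ} (hB : 0 < B) (hδ : 0 < δ) :
    Tendsto (fun n : ℕ => √(n : ℝ) * ∫ t in -δ..δ, exp (-(n * B / 2) * t ^ 2)) atTop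
      (𝓝 √(π / (B / 2))) := by
  rw [← integral_gaussian]
  have hn : Tendsto (fun n : ℕ => √(n : ℝ)) atTop atTop :=
    Real.tendsto_sqrt_atTop.comp tendsto_natCast_atTop_atTop
  have h := intervalIntegral_tendsto_integral (μ := volume)
    (integrable_exp_neg_mul_sq (b := B / 2) (by positivity))
    (hn.atTop_mul_const_of_neg (neg_neg_of_pos hδ)) (hn.atTop_mul_const hδ)
  refine h.congr fun n => ?_
  rw [← intervalIntegral.mul_integral_comp_mul_left]
  congr 2
  ext t
  rw [mul_pow, Real.sq_sqrt n.cast_nonneg]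
  ring_nf

lemma g_eq_exp {P s u : ℝ} (n : ℕ) (hu : 0 < 1 - u ^ 2) :
    g P s n u = exp (log (1 - u ^ 2) * (((n : ℝ) - 3) / 2) + n * √(P * s) * u) := by
  rw [g, Real.rpow_def_of_pos hu, ← Real.exp_add]

lemma g_nonneg {P s u : ℝ} (n : ℕ) (hu : u ∈ Set.Icc (-1 : ℝ) 1) : 0 ≤ g P s n u := by
  have : 0 ≤ 1 - u ^ 2 := by nlinarith [hu.1, hu.2]
  unfold g
  positivity

lemma continuous_g (P s : ℝ) {n : ℕ} (hn : 3 < n) : Continuous (g P s n) := by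
  have : (3 : ℝ) < n := by exact_mod_cast hn
  unfold g
  refine Continuous.mul ?_ (by fun_prop)
  exact Continuous.rpow_const (by fun_prop) fun u => Or.inr (by linarith)

lemma g_le_of_critical {P s v u : ℝ} {n : ℕ} (hn : 3 < n) (hv : 0 < 1 - v ^ 2)
    (hc : n * √(P * s) = (n - 3) * (v / (1 - v ^ 2))) (hu : u ∈ Set.Icc (-1 : ℝ) 1) :
    g P s n u ≤ g P s n v := by
  have hn' : (0 : ℝ) < (n - 3) / 2 := by
    have : (3 : ℝ) < n := by exact_mod_cast hn
    linarith
  have hu' : 0 ≤ 1 - u ^ 2 := by nlinarith [hu.1, hu.2]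
  rcases hu'.eq_or_lt with h | h
  · have : g P s n u = 0 := by rw [g, ← h, Real.zero_rpow hn'.ne', zero_mul]
    rw [this, g_eq_exp n hv]
    positivity
  · rw [g_eq_exp n hv, g_eq_exp n h, Real.exp_le_exp, hc]
    have := mul_le_mul_of_nonneg_right (log_one_sub_sq_le hv h) hn'.le
    linarith

lemma le_Fnorm {P s v B δ : ℝ} {n : ℕ} (hn : 3 < n) (hB : 0 ≤ B) (hδ : 0 < δ)
    (hv : 0 < 1 - v ^ 2) (hc : n * √(P * s) = (n - 3) * (v / (1 - v ^ 2)))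
    (H : ∀ t, |t| ≤ δ → 0 < 1 - (v + t) ^ 2 ∧
      log (1 - v ^ 2) - 2 * (v / (1 - v ^ 2)) * t - B * t ^ 2 ≤ log (1 - (v + t) ^ 2)) :
    g P s n v * ∫ t in -δ..δ, exp (-(n * B / 2) * t ^ 2) ≤ Fnorm P s n := by
  have hn' : (0 : ℝ) < (n - 3) / 2 := by
    have : (3 : ℝ) < n := by exact_mod_cast hn
    linarith
  have hpt : ∀ t ∈ Set.Icc (-δ) δ,
      g P s n v * exp (-(n * B / 2) * t ^ 2) ≤ g P s n (v + t) := by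
    intro t ht
    obtain ⟨h1, h2⟩ := H t (abs_le.2 ht)
    rw [g_eq_exp n hv, g_eq_exp n h1, ← Real.exp_add, Real.exp_le_exp, hc]
    have := mul_le_mul_of_nonneg_right h2 hn'.le
    have h3 : 0 ≤ B * t ^ 2 := by positivity
    linarith
  have hcont := continuous_g P s hn
  calc g P s n v * ∫ t in -δ..δ, exp (-(n * B / 2) * t ^ 2)
      = ∫ t in -δ..δ, g P s n v * exp (-(n * B / 2) * t ^ 2) := by
        rw [intervalIntegral.integral_const_mul]
    _ ≤ ∫ t in -δ..δ, g P s n (v + t) := by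
        refine intervalIntegral.integral_mono_on (by linarith) ?_ ?_ hpt
        · exact Continuous.intervalIntegrable (by fun_prop) _ _
        · exact Continuous.intervalIntegrable (by fun_prop) _ _
    _ = ∫ u in Set.Ioc (v + -δ) (v + δ), g P s n u := by
        rw [intervalIntegral.integral_comp_add_left (g P s n),
          intervalIntegral.integral_of_le (by linarith)]
    _ ≤ Fnorm P s n := by
        refine setIntegral_mono_set hcont.continuousOn.integrableOn_Icc ?_ ?_
        · exact (ae_restrict_iff' measurableSet_Icc).2 (ae_of_all _ fun u hu => g_nonneg n hu)
        · refine LE.le.eventuallyLE fun u hu => ?_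
          have h := (H (u - v) (abs_le.2 ⟨by linarith [hu.1], by linarith [hu.2]⟩)).1
          rw [add_sub_cancel] at h
          exact abs_le.1 ((sq_le_one_iff_abs_le_one u).1 (by linarith))

lemma nuMeasure_le {P s M C : ℝ} {n : ℕ} (hF : 0 < Fnorm P s n) (hC : 0 ≤ C) (hM : 0 ≤ M)
    (hg : ∀ u ∈ Set.Icc (-1 : ℝ) 1, g P s n u ≤ M) (hMF : M ≤ C * Fnorm P s n)
    {S : Set ℝ} (hS : MeasurableSet S) {ℓ : ℝ} (hℓ : 0 ≤ ℓ) (hvol : volume S ≤ ENNReal.ofReal ℓ)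
    (hSI : S ⊆ Set.Icc (-1) 1) :
    (nuMeasure P s n S).toReal ≤ C * ℓ := by
  refine ENNReal.toReal_le_of_le_ofReal (by positivity) ?_
  rw [nuMeasure, Measure.smul_apply, withDensity_apply _ hS, smul_eq_mul,
    Measure.restrict_restrict hS, Set.inter_eq_left.2 hSI]
  have h1 : ∫⁻ u in S, ENNReal.ofReal (g P s n u) ≤ ENNReal.ofReal M * ENNReal.ofReal ℓ :=
    calc ∫⁻ u in S, ENNReal.ofReal (g P s n u) ≤ ∫⁻ _ in S, ENNReal.ofReal M :=
          setLIntegral_mono' hS fun u hu => ENNReal.ofReal_le_ofReal (hg u (hSI hu))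
      _ ≤ ENNReal.ofReal M * ENNReal.ofReal ℓ := by
          rw [setLIntegral_const]
          gcongr
  calc (ENNReal.ofReal (Fnorm P s n))⁻¹ * ∫⁻ u in S, ENNReal.ofReal (g P s n u)
      ≤ (ENNReal.ofReal (Fnorm P s n))⁻¹ * (ENNReal.ofReal M * ENNReal.ofReal ℓ) := by gcongr
    _ = ENNReal.ofReal ((Fnorm P s n)⁻¹ * (M * ℓ)) := by
        rw [← ENNReal.ofReal_inv_of_pos hF, ← ENNReal.ofReal_mul hM,
          ← ENNReal.ofReal_mul (inv_nonneg.2 hF.le)]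
    _ ≤ ENNReal.ofReal (C * ℓ) := by
        refine ENNReal.ofReal_le_ofReal ?_
        rw [inv_mul_le_iff₀ hF]
        nlinarith [mul_le_mul_of_nonneg_right hMF hℓ]

lemma L_pos_and_le_sq {P s : ℝ} (hP : 0 < P) (hs : 0 < s) :
    0 < L P s ∧
      (1 + saddle √(P * s) ^ 2) / (1 - saddle √(P * s) ^ 2) ^ 2 ≤ 2 * π * L P s ^ 2 := by
  have hPs : 0 < P * s := mul_pos hP hs
  obtain ⟨r, hr⟩ : ∃ r, r = √(1 + 4 * P * s) := ⟨_, rfl⟩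
  have hr2 : r ^ 2 = 1 + 4 * P * s := by
    rw [hr]
    exact Real.sq_sqrt (by nlinarith)
  have hr1 : 1 < r := by
    rw [hr]
    exact Real.lt_sqrt_of_sq_lt (by nlinarith)
  have hr0 : 0 < r - 1 := by linarith
  have hrad : 0 < (1 + 4 * P * s - r) / (r - 1) ^ 5 := by
    rw [← hr2]
    have : 0 < r ^ 2 - r := by nlinarith
    positivity
  have hsq : 1 - saddle √(P * s) ^ 2 = 2 / (r + 1) := by
    rw [one_sub_saddle_sq, Real.sq_sqrt hPs.le, hr, mul_assoc 4 P s]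
  have hL : 2 * π * L P s ^ 2 = r * (r + 1) ^ 4 / 16 := by
    rw [L, ← hr, mul_pow, div_pow, Real.sq_sqrt hrad.le, Real.sq_sqrt (by positivity)]
    rw [← hr2, show 2 * P * s = (r ^ 2 - 1) / 2 by rw [hr2]; ring]
    field_simp
    ring
  refine ⟨?_, ?_⟩
  · rw [L, ← hr]
    have : 0 < 2 * P * s := by positivity
    have := Real.sqrt_pos.2 hrad
    positivity
  · rw [hL, show 1 + saddle √(P * s) ^ 2 = 2 - 2 / (r + 1) by rw [← hsq]; ring, hsq]
    have h1 : (2 - 2 / (r + 1)) / (2 / (r + 1)) ^ 2 = r * (r + 1) / 2 := by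
      field_simp
      ring
    rw [h1]
    have h2 : 8 ≤ (r + 1) ^ 3 := by
      calc (8 : ℝ) = 2 ^ 3 := by norm_num
        _ ≤ (r + 1) ^ 3 := by gcongr; linarith
    have h3 : 0 ≤ r * (r + 1) := by positivity
    nlinarith [mul_le_mul_of_nonneg_left h2 h3]

lemma volume_le_of_mul_mem_Icc {k : ℝ} (hk : 0 < k) (a μ : ℝ) (T : Set ℝ) :
    volume {u | u ∈ T ∧ k * u ∈ Set.Icc a (a + μ)} ≤ ENNReal.ofReal (μ / k) := by
  calc volume {u | u ∈ T ∧ k * u ∈ Set.Icc a (a + μ)}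
      ≤ volume (Set.Icc (a / k) ((a + μ) / k)) := by
        refine measure_mono fun u hu => ⟨?_, ?_⟩
        · rw [div_le_iff₀ hk]
          linarith [hu.2.1]
        · rw [le_div_iff₀ hk]
          linarith [hu.2.2]
    _ = ENNReal.ofReal (μ / k) := by
        rw [Real.volume_Icc]
        congr 1
        ring

/-- The `ν_n`-probability that `n √(Ps) u` falls in an interval of length `μ` is at most
`2 L(P,s) μ / √(nPs)`, for all sufficiently large `n`, uniformly in the interval. -/
theorem nu_interval_bound (P s : ℝ) (hP : 0 < P) (hs : 0 < s) :
    ∃ N : ℕ, ∀ n : ℕ, n ≥ N → ∀ a μ : ℝ, 0 < μ →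
      (nuMeasure P s n {u | u ∈ Set.Icc (-1 : ℝ) 1 ∧
          (n : ℝ) * Real.sqrt (P * s) * u ∈ Set.Icc a (a + μ)}).toReal
        ≤ 2 * L P s * μ / Real.sqrt (n * P * s) := by
  have hc : 0 < √(P * s) := Real.sqrt_pos.2 (mul_pos hP hs)
  obtain ⟨hL, hLA⟩ := L_pos_and_le_sq hP hs
  set c := √(P * s) with hcdef
  have hv₀ := one_sub_saddle_sq_pos c
  set A := (1 + saddle c ^ 2) / (1 - saddle c ^ 2) ^ 2 with hA
  have hApos : 0 < A := by positivity
  obtain ⟨δ, hδ, hev⟩ := exists_log_one_sub_sq_ge (B := 2 * A) hv₀ (by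
    rw [hA, mul_assoc, div_mul_cancel₀ _ (by positivity)]
    linarith [sq_nonneg (saddle c)])
  have hcn : Tendsto (fun n : ℕ => c * ((n : ℝ) / (n + -3))) atTop (𝓝 c) := by
    simpa using (tendsto_natCast_div_add_atTop (-3 : ℝ)).const_mul c
  have hgauss : ∀ᶠ n : ℕ in atTop,
      1 / (2 * L P s) < √(n : ℝ) * ∫ t in -δ..δ, exp (-(n * (2 * A) / 2) * t ^ 2) := by
    refine (tendsto_sqrt_mul_gaussian_integral (by positivity) hδ).eventually_const_lt ?_
    refine Real.lt_sqrt_of_sq_lt ?_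
    rw [div_pow, div_lt_div_iff₀ (by positivity) (by positivity)]
    nlinarith [mul_pos Real.pi_pos (pow_pos hL 2)]
  obtain ⟨N, hN⟩ := eventually_atTop.1
    (((continuous_saddle.tendsto c).comp hcn).eventually hev |>.and
      (hgauss.and (eventually_gt_atTop 3)))
  refine ⟨N, fun n hn a μ hμ => ?_⟩
  obtain ⟨H, hI, hn3⟩ := hN n hn
  have hn3' : (3 : ℝ) < n := by exact_mod_cast hn3
  have hne : (n : ℝ) + -3 ≠ 0 := by linarith
  have hn0 : (0 : ℝ) < n := by linarith
  dsimp only [Function.comp_apply] at H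
  have hv := one_sub_saddle_sq_pos (c * ((n : ℝ) / (n + -3)))
  have hcrit : n * c = (n - 3) * (saddle (c * ((n : ℝ) / (n + -3))) /
      (1 - saddle (c * ((n : ℝ) / (n + -3))) ^ 2)) := by
    rw [saddle_eq, sub_eq_add_neg]
    field_simp
  generalize saddle (c * ((n : ℝ) / (n + -3))) = v at H hv hcrit
  have hgv : 0 < g P s n v := by
    rw [g_eq_exp n hv]
    positivity
  have hF := le_Fnorm hn3 (by positivity) hδ hv hcrit H
  set I := ∫ t in -δ..δ, exp (-(n * (2 * A) / 2) * t ^ 2)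
  have hsn : 0 < √(n : ℝ) := Real.sqrt_pos.2 hn0
  rw [div_lt_iff₀ (by positivity)] at hI
  have hIpos : 0 < I := by
    by_contra! h
    nlinarith [mul_nonneg (mul_nonneg hsn.le (neg_nonneg.2 h)) hL.le]
  have hFpos : 0 < Fnorm P s n := (mul_pos hgv hIpos).trans_le hF
  have hMF : g P s n v ≤ (2 * L P s * √(n : ℝ)) * Fnorm P s n := by
    calc g P s n v ≤ (2 * L P s * √(n : ℝ)) * (g P s n v * I) := by
          nlinarith [mul_le_mul_of_nonneg_left hI.le hgv.le]
      _ ≤ _ := by gcongr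
  refine (nuMeasure_le (C := 2 * L P s * √(n : ℝ)) (M := g P s n v) (ℓ := μ / (n * c)) hFpos
    (by positivity) hgv.le (fun u hu => g_le_of_critical hn3 hv hcrit hu) hMF ?_
    (by positivity) (volume_le_of_mul_mem_Icc (by positivity) a μ _) fun u hu => hu.1).trans_eq ?_
  · exact measurableSet_Icc.inter (measurableSet_Icc.preimage (by fun_prop))
  · rw [mul_assoc (n : ℝ) P s, Real.sqrt_mul hn0.le, ← hcdef]
    have : √(n : ℝ) ^ 2 = n := Real.sq_sqrt hn0.le
    field_simp
    rw [this]

end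
end

section
/- Fix P > 0 and n ∈ ℕ, and let M ∈ ℕ. Let X and X̄ be independent, each uniformly distributed on the sphere S = {x ∈ ℝⁿ : ‖x‖₂² = nP}, let Z ∼ N(0, I_{n×n}) be independent of (X, X̄), and let Y = X + Z. Then there exists a code of M codewords on S with pairwise disjoint measurable decoding regions whose average error probability ε' over the AWGN channel Wⁿ satisfies ε' ≤ E[ min{ 1, M · Pr( ⟨X̄, Y⟩ ≥ ⟨X, Y⟩ | X, Y ) } ]. -/
open MeasureTheory ProbabilityTheory Real
open scoped ENNReal

noncomputable section

/-- The standard Gaussian measure `N(0, I_{n×n})` on `ℝⁿ`. -/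
def stdGaussian (n : ℕ) : Measure (Fin n → ℝ) := Measure.pi fun _ : Fin n => gaussianReal 0 1

/-- The uniform (normalized surface / Haar) distribution on the sphere
`{x ∈ ℝⁿ : ‖x‖₂² = nP}`, realized as the pushforward of the rotation-invariant standard
Gaussian measure under radial projection onto the sphere of radius `√(nP)`. -/
def sphereUniform (n : ℕ) (P : ℝ) : Measure (Fin n → ℝ) :=
  Measure.map (fun z => (Real.sqrt (n * P) / Real.sqrt (∑ i, z i ^ 2)) • z) (stdGaussian n)

/-- The `n`-fold AWGN channel with unit noise variance: `Wn n x D` is the probability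
that `x + Z ∈ D` where `Z` is an i.i.d. standard Gaussian vector. -/
def Wn (n : ℕ) (x : Fin n → ℝ) (D : Set (Fin n → ℝ)) : ℝ≥0∞ :=
  stdGaussian n {z | (fun i => x i + z i) ∈ D}

theorem measure_pi_exists_mem_le {α : Type*} [MeasurableSpace α] (μ : Measure α)
    [IsProbabilityMeasure μ] (k : ℕ) {A : Set α} (hA : MeasurableSet A) :
    (Measure.pi fun _ : Fin k => μ) {r | ∃ j, r j ∈ A} ≤ k * μ A := by
  have h : {r : Fin k → α | ∃ j, r j ∈ A} = ⋃ j, Function.eval j ⁻¹' A := by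
    ext r; simp
  rw [h]
  refine (measure_iUnion_fintype_le _ _).trans (le_of_eq ?_)
  have h' : ∀ j : Fin k, (Measure.pi fun _ : Fin k => μ) (Function.eval j ⁻¹' A) = μ A := fun j =>
    (measurePreserving_eval (fun _ : Fin k => μ) j).measure_preimage hA.nullMeasurableSet
  simp [h']

theorem measurableSet_exists_ne_mem {α β : Type*} [MeasurableSpace α] [MeasurableSpace β] {M : ℕ}
    (m : Fin M) {R : Set ((α × β) × α)} (hR : MeasurableSet R) :
    MeasurableSet {q : (Fin M → α) × β | ∃ j, j ≠ m ∧ ((q.1 m, q.2), q.1 j) ∈ R} := by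
  simp only [Set.ofPred_exists, Set.ofPred_and]
  refine MeasurableSet.iUnion fun j => (MeasurableSet.const _).inter ?_
  exact hR.preimage (f := fun q : (Fin M → α) × β => ((q.1 m, q.2), q.1 j)) (by fun_prop)

/-- The random-coding union bound for one message of an i.i.d. codebook, where `R` is the relation
describing which competitors confuse the decoder. -/
theorem lintegral_measure_exists_ne_mem_le {α β : Type*} [MeasurableSpace α] [MeasurableSpace β]
    (μ : Measure α) (γ : Measure β) [IsProbabilityMeasure μ] [IsProbabilityMeasure γ] {M : ℕ}
    (m : Fin M) {R : Set ((α × β) × α)} (hR : MeasurableSet R) :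
    ∫⁻ c, γ {z | ∃ j, j ≠ m ∧ ((c m, z), c j) ∈ R} ∂(Measure.pi fun _ : Fin M => μ) ≤
      ∫⁻ p, min 1 (M * μ {xb | (p, xb) ∈ R}) ∂(μ.prod γ) := by
  obtain _ | k := M
  · exact m.elim0
  let S : Set ((α × (Fin k → α)) × β) := {q | ∃ j, ((q.1.1, q.2), q.1.2 j) ∈ R}
  have hS : MeasurableSet S := by
    simp only [S, Set.ofPred_exists]
    refine MeasurableSet.iUnion fun j => ?_
    exact hR.preimage (f := fun q : (α × (Fin k → α)) × β => ((q.1.1, q.2), q.1.2 j))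
      (by fun_prop)
  have hSm : Measurable fun q : α × (Fin k → α) => γ {z | (q, z) ∈ S} :=
    measurable_measure_prodMk_left hS
  have hmp := measurePreserving_piFinSuccAbove (fun _ : Fin (k + 1) => μ) m
  have hL : ∀ c : Fin (k + 1) → α, {z | ∃ j, j ≠ m ∧ ((c m, z), c j) ∈ R} =
      {z | (MeasurableEquiv.piFinSuccAbove (fun _ : Fin (k + 1) => α) m c, z) ∈ S} := by
    intro c
    ext z
    simp only [S, Set.mem_ofPred_eq]
    constructor
    · rintro ⟨j, hj, h⟩
      obtain ⟨i, rfl⟩ := Fin.exists_succAbove_eq hj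
      exact ⟨i, h⟩
    · rintro ⟨i, h⟩
      exact ⟨m.succAbove i, Fin.succAbove_ne m i, h⟩
  simp_rw [hL]
  rw [hmp.lintegral_comp hSm, lintegral_prod _ hSm.aemeasurable, lintegral_prod]
  swap
  · exact (measurable_const.min
      (measurable_const.mul (measurable_measure_prodMk_left hR))).aemeasurable
  refine lintegral_mono fun x => ?_
  have hSx : MeasurableSet {q : (Fin k → α) × β | ((x, q.1), q.2) ∈ S} :=
    hS.preimage (f := fun q : (Fin k → α) × β => ((x, q.1), q.2)) (by fun_prop)
  calc ∫⁻ r, γ {z | ((x, r), z) ∈ S} ∂(Measure.pi fun _ : Fin k => μ)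
      = ((Measure.pi fun _ : Fin k => μ).prod γ) {q | ((x, q.1), q.2) ∈ S} :=
        (Measure.prod_apply hSx).symm
    _ = ∫⁻ z, (Measure.pi fun _ : Fin k => μ) {r | ((x, r), z) ∈ S} ∂γ :=
        Measure.prod_apply_symm hSx
    _ ≤ _ := by
        refine lintegral_mono fun z => le_min prob_le_one ?_
        refine (measure_pi_exists_mem_le μ k (A := {xb | ((x, z), xb) ∈ R})
          (hR.preimage measurable_prodMk_left)).trans ?_
        gcongr
        exact Nat.le_succ k

/-- Some codebook, with all codewords in a given set of full measure, performs at least as well as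
the average over i.i.d. codebooks. -/
theorem exists_codebook_sum_le {α β : Type*} [MeasurableSpace α] [MeasurableSpace β]
    (μ : Measure α) (γ : Measure β) [IsProbabilityMeasure μ] [IsProbabilityMeasure γ] (M : ℕ)
    {R : Set ((α × β) × α)} (hR : MeasurableSet R) {p : α → Prop} (hp : ∀ᵐ x ∂μ, p x) :
    ∃ c : Fin M → α, (∀ m, p (c m)) ∧
      ∑ m, γ {z | ∃ j, j ≠ m ∧ ((c m, z), c j) ∈ R} ≤
        M * ∫⁻ p, min 1 (M * μ {xb | (p, xb) ∈ R}) ∂(μ.prod γ) := by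
  have hae : ∀ᵐ c ∂(Measure.pi fun _ : Fin M => μ), ∀ m, p (c m) :=
    ae_all_iff.2 fun m =>
      (measurePreserving_eval (fun _ : Fin M => μ) m).quasiMeasurePreserving.ae hp
  have hmeas : ∀ m : Fin M, Measurable fun c : Fin M → α =>
      γ {z | ∃ j, j ≠ m ∧ ((c m, z), c j) ∈ R} := fun m =>
    measurable_measure_prodMk_left (measurableSet_exists_ne_mem m hR)
  obtain ⟨c, hc, hle⟩ := exists_notMem_null_le_lintegral (μ := Measure.pi fun _ : Fin M => μ)
    (f := fun c => ∑ m, γ {z | ∃ j, j ≠ m ∧ ((c m, z), c j) ∈ R})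
    (Finset.measurable_sum _ fun m _ => hmeas m).aemeasurable (ae_iff.1 hae)
  refine ⟨c, by simpa using hc, hle.trans ?_⟩
  rw [lintegral_finsetSum _ fun m _ => hmeas m]
  refine (Finset.sum_le_sum fun m _ => lintegral_measure_exists_ne_mem_le μ γ m hR).trans ?_
  simp

instance isProbabilityMeasure_stdGaussian (n : ℕ) :
    IsProbabilityMeasure (_root_.stdGaussian n) := by
  unfold _root_.stdGaussian; infer_instance

theorem measurable_radialProjection (n : ℕ) (P : ℝ) : Measurable fun z : Fin n → ℝ =>
    (Real.sqrt (n * P) / Real.sqrt (∑ i, z i ^ 2)) • z := by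
  fun_prop

instance isProbabilityMeasure_sphereUniform (n : ℕ) (P : ℝ) :
    IsProbabilityMeasure (sphereUniform n P) :=
  Measure.isProbabilityMeasure_map (measurable_radialProjection n P).aemeasurable

theorem ae_sphereUniform_sum_sq_eq {P : ℝ} (hP : 0 ≤ P) (n : ℕ) :
    ∀ᵐ x ∂(sphereUniform n P), ∑ i, x i ^ 2 = n * P := by
  obtain _ | k := n
  · simp
  rw [sphereUniform, ae_map_iff (measurable_radialProjection _ P).aemeasurable
    (measurableSet_eq_fun (by fun_prop) (by fun_prop))]
  have hne : ∀ᵐ z ∂(_root_.stdGaussian (k + 1)), z ≠ 0 := by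
    have : NullSingletonClass (gaussianReal 0 1) := nullSingletonClass_gaussianReal one_ne_zero
    have : NullSingletonClass (_root_.stdGaussian (k + 1)) := Measure.pi_nullSingletonClass (0 : Fin (k + 1))
    exact Measure.ae_ne _ 0
  filter_upwards [hne] with z hz
  have hpos : 0 < ∑ i, z i ^ 2 := by
    obtain ⟨i, hi⟩ := Function.ne_iff.1 hz
    exact Finset.sum_pos' (fun i _ => sq_nonneg _) ⟨i, Finset.mem_univ _, sq_pos_of_ne_zero hi⟩
  simp only [Pi.smul_apply, smul_eq_mul, mul_pow, ← Finset.mul_sum, div_pow]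
  rw [Real.sq_sqrt hpos.le, Real.sq_sqrt (by positivity), div_mul_cancel₀ _ hpos.ne']

/-- The random-coding union (RCU) bound for spherical random coding over the AWGN channel:
there is a code of `M` codewords on the power sphere, with pairwise disjoint measurable
decoding regions, whose average error probability `ε'` satisfies
`ε' ≤ E[min{1, M Pr(⟨X̄,Y⟩ ≥ ⟨X,Y⟩ | X, Y)}]`, where `X, X̄` are i.i.d. uniform on the
sphere, `Z` is standard Gaussian independent of them, and `Y = X + Z` (so that the inner
conditional probability is the `sphereUniform`-mass of `{x̄ : ⟨x̄,Y⟩ ≥ ⟨X,Y⟩}`). -/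
theorem rcu_bound_sphere (P : ℝ) (hP : 0 < P) (n M : ℕ) :
    ∃ (x : Fin M → Fin n → ℝ) (D : Fin M → Set (Fin n → ℝ)),
      (∀ m, ∑ i, x m i ^ 2 = n * P) ∧
      (∀ m, MeasurableSet (D m)) ∧
      (∀ m m', m ≠ m' → Disjoint (D m) (D m')) ∧
      (1 / M : ℝ) * ∑ m, (Wn n (x m) (D m)ᶜ).toReal ≤
        ∫ p, min 1 (M * ((sphereUniform n P)
            {xb | (∑ i, p.1 i * (p.1 i + p.2 i)) ≤ ∑ i, xb i * (p.1 i + p.2 i)}).toReal)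
          ∂((sphereUniform n P).prod (stdGaussian n)) := by
  let R : Set (((Fin n → ℝ) × (Fin n → ℝ)) × (Fin n → ℝ)) :=
    {q | ∑ i, q.1.1 i * (q.1.1 i + q.1.2 i) ≤ ∑ i, q.2 i * (q.1.1 i + q.1.2 i)}
  have hR : MeasurableSet R := measurableSet_le (by fun_prop) (by fun_prop)
  obtain ⟨c, hc, hle⟩ := exists_codebook_sum_le (sphereUniform n P) (_root_.stdGaussian n) M hR
    (ae_sphereUniform_sum_sq_eq hP.le n)
  refine ⟨c, fun m => {y | ∀ j, j ≠ m → ∑ i, c j i * y i < ∑ i, c m i * y i}, hc, fun m => ?_,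
    fun m m' hm => ?_, ?_⟩
  · simp only [Set.ofPred_forall]
    exact MeasurableSet.iInter fun j => MeasurableSet.iInter fun _ =>
      measurableSet_lt (by fun_prop) (by fun_prop)
  · exact Set.disjoint_left.2 fun y hy hy' => lt_asymm (hy m' hm.symm) (hy' m hm)
  have hW : ∀ m, Wn n (c m) {y | ∀ j, j ≠ m → ∑ i, c j i * y i < ∑ i, c m i * y i}ᶜ =
      _root_.stdGaussian n {z | ∃ j, j ≠ m ∧ ((c m, z), c j) ∈ R} := by
    intro m
    unfold Wn
    congr 1
    ext z
    simp [R]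
  set I := ∫⁻ p, min 1 (M * sphereUniform n P {xb | (p, xb) ∈ R})
    ∂((sphereUniform n P).prod (_root_.stdGaussian n)) with hI
  have hI_le : I ≤ 1 := (lintegral_mono fun p => min_le_left _ _).trans (by simp)
  have hint : ∫ p, min 1 (M * ((sphereUniform n P)
        {xb | (∑ i, p.1 i * (p.1 i + p.2 i)) ≤ ∑ i, xb i * (p.1 i + p.2 i)}).toReal)
      ∂((sphereUniform n P).prod (_root_.stdGaussian n)) = I.toReal := by
    rw [hI, ← integral_toReal]
    · refine integral_congr_ae (.of_forall fun p => ?_)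
      simp only [R, Set.mem_ofPred_eq]
      rw [ENNReal.toReal_min ENNReal.one_ne_top (ENNReal.mul_ne_top (by simp) (by simp))]
      simp
    · exact (measurable_const.min
        (measurable_const.mul (measurable_measure_prodMk_left hR))).aemeasurable
    · exact .of_forall fun p => (min_le_left _ _).trans_lt ENNReal.one_lt_top
  rw [hint]
  simp_rw [hW]
  rw [← ENNReal.toReal_sum fun m _ => measure_ne_top _ _]
  have hreal := ENNReal.toReal_mono
    (ENNReal.mul_ne_top (by simp) (hI_le.trans_lt ENNReal.one_lt_top).ne) hle
  rw [ENNReal.toReal_mul, ENNReal.toReal_natCast] at hreal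
  obtain rfl | hM := Nat.eq_zero_or_pos M
  · simp
  · have hM' : (0 : ℝ) < M := by exact_mod_cast hM
    rw [one_div, inv_mul_le_iff₀ hM']
    exact hreal

end
end
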